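/- Let k ≥ 3 be an odd integer and let G_k be the graph obtained from k disjoint copies of H', indexed cyclically by 0,1,...,k-1, by adding for each index i the edge joining the vertex v1 of copy i to the vertex v0 of copy i+1 (indices taken modulo k), so that the distinguished vertices of the k copies form a cycle of length 2k meeting every copy. Then no subcubic simple graph containing G_k as a subgraph has a good coloring. -/

import Mathlib

/-- A 2-coloring of the vertices is encoded by `red : V → Prop`;
`red v` means `v` is colored red, otherwise `v` is blue.
A *good coloring* requires:
(1) the subgraph induced by blue vertices has maximum degree at most 1,
(2) the subgraph induced by red vertices has minimum degree at least 1,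
(3) the subgraph induced by red vertices contains no path on 4 vertices. -/
def IsGoodColoring {V : Type*} (G : SimpleGraph V) (red : V → Prop) : Prop :=
  (∀ v w₁ w₂ : V, ¬ red v → ¬ red w₁ → ¬ red w₂ →
      G.Adj v w₁ → G.Adj v w₂ → w₁ = w₂) ∧
  (∀ v : V, red v → ∃ w : V, red w ∧ G.Adj v w) ∧
  (∀ a b c d : V, red a → red b → red c → red d →
      a ≠ c → a ≠ d → b ≠ d →
      ¬ (G.Adj a b ∧ G.Adj b c ∧ G.Adj c d))

/-- A graph is subcubic if every vertex has degree at most 3. -/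
def Subcubic {V : Type*} (G : SimpleGraph V) : Prop :=
  ∀ v : V, (G.neighborSet v).encard ≤ 3

/-- Adjacency in the graph `H`: the 8-cycle `v₀v₁…v₇v₀` together with the
two chords `v₂v₆` and `v₃v₇`. -/
def HAdj (i j : Fin 8) : Prop :=
  (j = i + 1 ∨ i = j + 1) ∨
  (i = 2 ∧ j = 6) ∨ (i = 6 ∧ j = 2) ∨ (i = 3 ∧ j = 7) ∨ (i = 7 ∧ j = 3)

/-- Adjacency in the graph `H'`: two disjoint copies of `H` (copy `0` on the
`vᵢ`'s and copy `1` on the `uᵢ`'s), together with the joining edges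
`v₄u₀` and `v₅u₁`.  Vertex `(c, i)` is vertex `i` of copy `c`. -/
def H'Adj (p q : Fin 2 × Fin 8) : Prop :=
  (p.1 = q.1 ∧ HAdj p.2 q.2) ∨
  (p = (0, 4) ∧ q = (1, 0)) ∨ (p = (1, 0) ∧ q = (0, 4)) ∨
  (p = (0, 5) ∧ q = (1, 1)) ∨ (p = (1, 1) ∧ q = (0, 5))

/-- Adjacency in the graph `G_k` obtained from `k` copies of `H'` (indexed
cyclically by `ZMod k`) by joining, for each `i`, the distinguished vertex
`v₁ = (0,1)` of copy `i` to the distinguished vertex `v₀ = (0,0)` of copy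
`i+1`, so that the distinguished vertices form a cycle of length `2k`. -/
def GkAdj (k : ℕ) (p q : ZMod k × Fin 2 × Fin 8) : Prop :=
  (p.1 = q.1 ∧ H'Adj p.2 q.2) ∨
  (p.2 = (0, 1) ∧ q.2 = (0, 0) ∧ q.1 = p.1 + 1) ∨
  (p.2 = (0, 0) ∧ q.2 = (0, 1) ∧ p.1 = q.1 + 1)

instance : DecidableRel HAdj := fun i j => by unfold HAdj; infer_instance

section

variable {V : Type*} {G : SimpleGraph V} {red : V → Prop}

/-- In a subcubic graph a vertex with three distinct neighbours has no others. -/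
lemma Subcubic.eq_of_adj (hG : Subcubic G) {v a b c w : V} (ha : G.Adj v a) (hb : G.Adj v b)
    (hc : G.Adj v c) (hab : a ≠ b) (hac : a ≠ c) (hbc : b ≠ c) (hw : G.Adj v w) :
    w = a ∨ w = b ∨ w = c := by
  by_contra! h
  obtain ⟨hwa, hwb, hwc⟩ := h
  have hle : ({w, a, b, c} : Set V).encard ≤ 3 := by
    refine (Set.encard_le_encard ?_).trans (hG v)
    rintro x (rfl | rfl | rfl | rfl) <;> assumption
  rw [Set.encard_insert_of_notMem (by simp [hwa, hwb, hwc]),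
    Set.encard_insert_of_notMem (by simp [hab, hac]), Set.encard_pair hbc] at hle
  exact absurd hle (by norm_num)

/-- A red vertex with three distinct neighbours in a subcubic graph has a red one among them. -/
lemma IsGoodColoring.exists_red (h : IsGoodColoring G red) (hG : Subcubic G) {v a b c : V}
    (ha : G.Adj v a) (hb : G.Adj v b) (hc : G.Adj v c) (hab : a ≠ b) (hac : a ≠ c) (hbc : b ≠ c)
    (hv : red v) : red a ∨ red b ∨ red c := by
  obtain ⟨w, hw, hvw⟩ := h.2.1 v hv
  rcases hG.eq_of_adj ha hb hc hab hac hbc hvw with rfl | rfl | rfl <;> simp [hw]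

/-- A vertex with two distinct neighbours is not blue together with both of them. -/
lemma IsGoodColoring.red_of_adj (h : IsGoodColoring G red) {v a b : V} (ha : G.Adj v a)
    (hb : G.Adj v b) (hab : a ≠ b) : red v ∨ red a ∨ red b := by
  by_contra! hr
  exact hab (h.1 v a b hr.1 hr.2.1 hr.2.2 ha hb)

/-- A copy of `H`, as a not necessarily induced subgraph of `G`. -/
structure IsHCopy (G : SimpleGraph V) (g : Fin 8 → V) : Prop where
  injective : Function.Injective g
  adj : ∀ i j, HAdj i j → G.Adj (g i) (g j)

namespace IsHCopy

variable {g : Fin 8 → V}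

/-- The reflection `i ↦ 1 - i` is an automorphism of `H`. -/
lemma reflect (hg : IsHCopy G g) : IsHCopy G (fun i => g (1 - i)) where
  injective _ _ hij := sub_right_injective (hg.injective hij)
  adj i j hij := hg.adj _ _ ((by decide : ∀ i j, HAdj i j → HAdj (1 - i) (1 - j)) i j hij)

lemma blue (hg : IsHCopy G g) (h : IsGoodColoring G red) (i j k : Fin 8)
    (hH : HAdj i j ∧ HAdj i k ∧ j ≠ k) : red (g i) ∨ red (g j) ∨ red (g k) :=
  h.red_of_adj (hg.adj _ _ hH.1) (hg.adj _ _ hH.2.1) (hg.injective.ne hH.2.2)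

lemma path (hg : IsHCopy G g) (h : IsGoodColoring G red) (i j k l : Fin 8)
    (hH : (HAdj i j ∧ HAdj j k ∧ HAdj k l) ∧ i ≠ k ∧ i ≠ l ∧ j ≠ l) :
    ¬ (red (g i) ∧ red (g j) ∧ red (g k) ∧ red (g l)) := fun hr =>
  h.2.2 _ _ _ _ hr.1 hr.2.1 hr.2.2.1 hr.2.2.2 (hg.injective.ne hH.2.1)
    (hg.injective.ne hH.2.2.1) (hg.injective.ne hH.2.2.2)
    ⟨hg.adj _ _ hH.1.1, hg.adj _ _ hH.1.2.1, hg.adj _ _ hH.1.2.2⟩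

lemma closed (hg : IsHCopy G g) (hG : Subcubic G) (h : IsGoodColoring G red) (i a b c : Fin 8)
    (hH : (HAdj i a ∧ HAdj i b ∧ HAdj i c) ∧ a ≠ b ∧ a ≠ c ∧ b ≠ c) (hi : red (g i)) :
    red (g a) ∨ red (g b) ∨ red (g c) :=
  h.exists_red hG (hg.adj _ _ hH.1.1) (hg.adj _ _ hH.1.2.1) (hg.adj _ _ hH.1.2.2)
    (hg.injective.ne hH.2.1) (hg.injective.ne hH.2.2.1) (hg.injective.ne hH.2.2.2) hi

/-- In a good coloring, `v₀` and `v₁` are not both red. -/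
lemma not_red_red (hg : IsHCopy G g) (hG : Subcubic G) (h : IsGoodColoring G red) :
    ¬ (red (g 0) ∧ red (g 1)) := by
  have path_7012 := hg.path h 7 0 1 2 (by decide)
  have path_0123 := hg.path h 0 1 2 3 (by decide)
  have path_0126 := hg.path h 0 1 2 6 (by decide)
  have path_1076 := hg.path h 1 0 7 6 (by decide)
  have path_1073 := hg.path h 1 0 7 3 (by decide)
  have path_3456 := hg.path h 3 4 5 6 (by decide)
  have blue_2 := hg.blue h 2 3 6 (by decide)
  have blue_7 := hg.blue h 7 3 6 (by decide)
  have blue_6 := hg.blue h 6 2 7 (by decide)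
  have blue_3 := hg.blue h 3 2 7 (by decide)
  have closed_3 := hg.closed hG h 3 2 4 7 (by decide)
  have closed_6 := hg.closed hG h 6 2 5 7 (by decide)
  grind

/-- In a good coloring, if `v₁` and `v₂` are red then `v₄` and `v₅` are blue. -/
lemma blue_of_red_red (hg : IsHCopy G g) (hG : Subcubic G) (h : IsGoodColoring G red)
    (h1 : red (g 1)) (h2 : red (g 2)) : ¬ red (g 4) ∧ ¬ red (g 5) := by
  have not_red_0 := hg.not_red_red hG h
  have path_1267 := hg.path h 1 2 6 7 (by decide)
  have path_1237 := hg.path h 1 2 3 7 (by decide)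
  have path_1234 := hg.path h 1 2 3 4 (by decide)
  have path_1265 := hg.path h 1 2 6 5 (by decide)
  have blue_3 := hg.blue h 7 0 3 (by decide)
  have blue_6 := hg.blue h 7 0 6 (by decide)
  have closed_7 := hg.closed hG h 7 0 3 6 (by decide)
  tauto

/-- Suppose two disjoint copies of `H` are joined as in `H'` by edges `v₄u₀` and `v₅u₁`. In a good
coloring, `v₁` and `v₂` are not both red. -/
lemma not_red_red_of_joined {g' : Fin 8 → V} (hg : IsHCopy G g) (hg' : IsHCopy G g')
    (hG : Subcubic G) (h : IsGoodColoring G red) (hdisj : ∀ i j, g i ≠ g' j)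
    (h40 : G.Adj (g 4) (g' 0)) (h51 : G.Adj (g 5) (g' 1)) : ¬ (red (g 1) ∧ red (g 2)) := by
  rintro ⟨h1, h2⟩
  obtain ⟨h4, h5⟩ := hg.blue_of_red_red hG h h1 h2
  have red_0 := h.red_of_adj (hg.adj 4 5 (by decide)) h40 (hdisj 5 0)
  have red_1 := h.red_of_adj (hg.adj 5 4 (by decide)) h51 (hdisj 4 1)
  have := hg'.not_red_red hG h
  tauto

end IsHCopy

end

/-- A predicate on `ZMod k` cannot alternate when `k` is odd. -/
lemma not_alternating_of_odd {k : ℕ} (hk : Odd k) (a : ZMod k → Prop) :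
    ¬ ∀ i, a (i + 1) ↔ ¬ a i := by
  intro ha
  have key : ∀ n : ℕ, a n ↔ (a 0 ↔ Even n) := by
    intro n
    induction n with
    | zero => simp
    | succ n ih =>
      rw [Nat.cast_succ, ha, ih, Nat.even_add_one]
      tauto
  have hkk := key k
  rw [ZMod.natCast_self] at hkk
  have := Nat.not_even_iff_odd.mpr hk
  tauto

/-- For every odd `k ≥ 3`, no subcubic simple graph containing `G_k` as a
subgraph has a good coloring. -/
theorem no_good_coloring_of_Gk_subgraph (k : ℕ) (hk3 : 3 ≤ k) (hkodd : Odd k)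
    {V : Type*} (G : SimpleGraph V) (hG : Subcubic G)
    (f : ZMod k × Fin 2 × Fin 8 → V) (hinj : Function.Injective f)
    (hsub : ∀ p q : ZMod k × Fin 2 × Fin 8, GkAdj k p q → G.Adj (f p) (f q)) :
    ¬ ∃ red : V → Prop, IsGoodColoring G red := by
  rintro ⟨red, h⟩
  have : Fact (1 < k) := ⟨by omega⟩
  have hv (i : ZMod k) (c : Fin 2) : IsHCopy G (fun j => f (i, c, j)) :=
    ⟨fun _ _ hjj => by simpa using hinj hjj, fun _ _ hjj => hsub _ _ (.inl ⟨rfl, .inl ⟨rfl, hjj⟩⟩)⟩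
  have hdisj (i : ZMod k) (j j' : Fin 8) : f (i, 0, j) ≠ f (i, 1, j') := hinj.ne (by simp)
  have h40 (i : ZMod k) : G.Adj (f (i, 0, 4)) (f (i, 1, 0)) :=
    hsub _ _ (.inl ⟨rfl, .inr (.inl ⟨rfl, rfl⟩)⟩)
  have h51 (i : ZMod k) : G.Adj (f (i, 0, 5)) (f (i, 1, 1)) :=
    hsub _ _ (.inl ⟨rfl, .inr (.inr (.inr (.inl ⟨rfl, rfl⟩)))⟩)
  have hring (i : ZMod k) : G.Adj (f (i, 0, 1)) (f (i + 1, 0, 0)) :=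
    hsub _ _ (.inr (.inl ⟨rfl, rfl, rfl⟩))
  have h01 (i : ZMod k) : ¬ (red (f (i, 0, 0)) ∧ red (f (i, 0, 1))) := (hv i 0).not_red_red hG h
  have h12 (i : ZMod k) : ¬ (red (f (i, 0, 1)) ∧ red (f (i, 0, 2))) :=
    (hv i 0).not_red_red_of_joined (hv i 1) hG h (hdisj i) (h40 i) (h51 i)
  have h07 (i : ZMod k) : ¬ (red (f (i, 0, 0)) ∧ red (f (i, 0, 7))) :=
    (hv i 0).reflect.not_red_red_of_joined (hv i 1).reflect hG h (fun _ _ => hdisj i _ _)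
      (h51 i) (h40 i)
  have hnext (i : ZMod k) (hi : red (f (i, 0, 1))) : red (f (i + 1, 0, 0)) := by
    have := h.exists_red hG ((hv i 0).adj 1 0 (by decide)) ((hv i 0).adj 1 2 (by decide)) (hring i)
      (hinj.ne (by simp)) (hinj.ne (by simp)) (hinj.ne (by simp)) hi
    have := h01 i
    have := h12 i
    tauto
  have hprev (i : ZMod k) (hi : red (f (i + 1, 0, 0))) : red (f (i, 0, 1)) := by
    have := h.exists_red hG ((hv (i + 1) 0).adj 0 1 (by decide))
      ((hv (i + 1) 0).adj 0 7 (by decide)) (hring i).symm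
      (hinj.ne (by simp)) (hinj.ne (by simp)) (hinj.ne (by simp)) hi
    have := h01 (i + 1)
    have := h07 (i + 1)
    tauto
  refine not_alternating_of_odd hkodd (fun i => red (f (i, 0, 0))) fun i => ?_
  have := h.red_of_adj ((hv i 0).adj 1 0 (by decide)) (hring i) (hinj.ne (by simp))
  have := h01 i
  have := hnext i
  have := hprev i
  tauto
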